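/- Every saturated packing of the Euclidean plane E^2 with closed unit disks has lower density at least π/(6√3), and there exists a saturated packing of E^2 with closed unit disks whose density exists and equals π/(6√3). Hence Δ_1(B^2) = π/(6√3) = 0.302299…. -/

import Mathlib

open Set MeasureTheory

noncomputable section

/-- The Euclidean plane. -/
abbrev Euc2 := EuclideanSpace ℝ (Fin 2)

/-- A packing of the plane with closed unit disks. -/
def IsUnitDiskPacking (P : Set (Set Euc2)) : Prop :=
  (∀ L ∈ P, ∃ x : Euc2, L = Metric.closedBall x 1) ∧
  P.Pairwise fun A B => Disjoint (interior A) (interior B)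

/-- A packing with unit disks is saturated (`1`-saturated) if no further closed unit
disk can be added whose interior avoids the interiors of all members. -/
def IsSaturatedDiskPacking (P : Set (Set Euc2)) : Prop :=
  IsUnitDiskPacking P ∧
  ¬ ∃ x : Euc2, ∀ M ∈ P,
      Disjoint (interior (Metric.closedBall x 1)) (interior M)

/-- The density of a family of sets relative to the disk of radius `r` about the
origin. -/
def densityIn (A : Set (Set Euc2)) (r : ℝ) : ENNReal :=
  (∑' L : A, volume ((L : Set Euc2) ∩ Metric.ball 0 r)) /
    volume (Metric.ball (0 : Euc2) r)

/-- The lower density of a family of sets. -/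
def lowerDensity (A : Set (Set Euc2)) : ENNReal :=
  Filter.liminf (fun r : ℝ => densityIn A r) Filter.atTop

/-- The determinant of the vectors `u` and `v`. -/
def planeCross (u v : Euc2) : ℝ := u 0 * v 1 - u 1 * v 0

lemma volume_setOf_inner_eq {v : Euc2} (hv : v ≠ 0) (k : ℝ) :
    volume {y : Euc2 | inner ℝ v y = k} = 0 := by
  rcases Set.eq_empty_or_nonempty {y : Euc2 | inner ℝ v y = k} with h | ⟨y₀, hy₀⟩
  · simp [h]
  · have hker : LinearMap.ker (innerSL ℝ v).toLinearMap ≠ ⊤ := by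
      intro h
      have : v ∈ LinearMap.ker (innerSL ℝ v).toLinearMap := h ▸ Submodule.mem_top
      simp [hv] at this
    rw [← Measure.addHaar_submodule volume _ hker, ← measure_preimage_add volume y₀]
    congr 1
    ext y
    have : inner ℝ v y₀ = k := hy₀
    simp [inner_add_right, this]

lemma volume_standard_triangle_le :
    volume {x : Euc2 | 0 ≤ x 0 ∧ 0 ≤ x 1 ∧ x 0 + x 1 ≤ 1} ≤ ENNReal.ofReal (1 / 2) := by
  set T : Set Euc2 := {x : Euc2 | 0 ≤ x 0 ∧ 0 ≤ x 1 ∧ x 0 + x 1 ≤ 1} with hT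
  set w : Euc2 := !₂[1, 1] with hw
  set T' : Set Euc2 := (fun x => w - x) ⁻¹' T with hT'
  have hclosed : IsClosed T := by
    have h0 : Continuous fun x : Euc2 => x 0 := by fun_prop
    have h1 : Continuous fun x : Euc2 => x 1 := by fun_prop
    exact (isClosed_le continuous_const h0).inter
      ((isClosed_le continuous_const h1).inter (isClosed_le (h0.add h1) continuous_const))
  have hvol : volume T' = volume T := by
    rw [← measure_preimage_add volume w T, ← Measure.measure_preimage_neg]
    congr 1
    ext x
    simp [hT', sub_eq_add_neg]
  have hw0 : w ≠ 0 := by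
    intro h
    have := congrArg (fun z : Euc2 => z 0) h
    simp [hw] at this
  have hdisj : AEDisjoint volume T T' := by
    refine measure_mono_null ?_ (volume_setOf_inner_eq hw0 1)
    rintro x ⟨⟨_, _, h1⟩, ⟨_, _, h2⟩⟩
    simp [hw, PiLp.inner_apply, Fin.sum_univ_two] at h2 ⊢
    linarith
  have hsq : volume (T ∪ T') ≤ 1 := by
    have hsub : T ∪ T' ⊆ (WithLp.ofLp : Euc2 → Fin 2 → ℝ) ⁻¹' Set.Icc 0 1 := by
      rintro x (⟨h0, h1, h2⟩ | ⟨h0, h1, h2⟩)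
      · simp only [Set.mem_preimage, Set.mem_Icc, Pi.le_def, Fin.forall_fin_two]
        simp; constructor <;> constructor <;> linarith
      · simp only [Set.mem_preimage, Set.mem_Icc, Pi.le_def, Fin.forall_fin_two]
        simp [hw] at h0 h1 h2 ⊢; constructor <;> constructor <;> linarith
    refine (measure_mono hsub).trans ?_
    rw [(PiLp.volume_preserving_ofLp (Fin 2)).measure_preimage
      measurableSet_Icc.nullMeasurableSet, Real.volume_Icc_pi]
    simp
  rw [measure_union₀' hclosed.measurableSet.nullMeasurableSet hdisj, hvol, ← two_mul] at hsq
  have h2 : ENNReal.ofReal (1 / 2) = 2⁻¹ := by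
    rw [one_div, ENNReal.ofReal_inv_of_pos two_pos]; simp
  rw [h2, ENNReal.le_inv_iff_mul_le, mul_comm]
  exact hsq

lemma convexHull_triple_eq (a b c : Euc2) :
    convexHull ℝ {a, b, c} =
      {x | ∃ s t : ℝ, 0 ≤ s ∧ 0 ≤ t ∧ s + t ≤ 1 ∧ x = a + (s • (b - a) + t • (c - a))} := by
  apply Set.Subset.antisymm
  · apply convexHull_min
    · rintro x (rfl | rfl | rfl)
      · exact ⟨0, 0, by simp⟩
      · exact ⟨1, 0, by simp⟩
      · exact ⟨0, 1, by simp⟩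
    · rintro _ ⟨s, t, hs, ht, hst, rfl⟩ _ ⟨s', t', hs', ht', hst', rfl⟩ p q hp hq hpq
      refine ⟨p * s + q * s', p * t + q * t', by positivity, by positivity, by nlinarith, ?_⟩
      have : q = 1 - p := by linarith
      subst this
      module
  · rintro _ ⟨s, t, hs, ht, hst, rfl⟩
    have hc := convex_convexHull ℝ ({a, b, c} : Set Euc2)
    have ha : a ∈ convexHull ℝ ({a, b, c} : Set Euc2) := subset_convexHull ℝ _ (by simp)
    have hb : b ∈ convexHull ℝ ({a, b, c} : Set Euc2) := subset_convexHull ℝ _ (by simp)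
    have hc' : c ∈ convexHull ℝ ({a, b, c} : Set Euc2) := subset_convexHull ℝ _ (by simp)
    have := hc.sum_mem (t := Finset.univ) (w := ![1 - s - t, s, t]) (z := ![a, b, c])
      (by intro i _; fin_cases i <;> simp <;> linarith)
      (by simp [Fin.sum_univ_three]; ring)
      (by intro i _; fin_cases i <;> simp <;> assumption)
    convert this using 1
    simp [Fin.sum_univ_three]
    module

lemma volume_convexHull_triple_le (a b c : Euc2) :
    volume (convexHull ℝ {a, b, c}) ≤
      ENNReal.ofReal (|planeCross (b - a) (c - a)| / 2) := by
  set B := (EuclideanSpace.basisFun (Fin 2) ℝ).toBasis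
  set f : Euc2 →ₗ[ℝ] Euc2 :=
    Matrix.toLin B B !![(b - a) 0, (c - a) 0; (b - a) 1, (c - a) 1] with hf
  have hdet : LinearMap.det f = planeCross (b - a) (c - a) := by
    rw [hf, LinearMap.det_toLin, Matrix.det_fin_two_of, planeCross]; ring
  have happ : ∀ x : Euc2, f x = x 0 • (b - a) + x 1 • (c - a) := by
    intro x
    rw [hf, ← Matrix.toEuclideanLin_eq_toLin_orthonormal]
    ext i
    fin_cases i <;> simp [Matrix.toLpLin_apply, dotProduct, Fin.sum_univ_two] <;> ring
  have hsub : convexHull ℝ {a, b, c} ⊆ (fun x => -a + x) ⁻¹'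
      (f '' {x : Euc2 | 0 ≤ x 0 ∧ 0 ≤ x 1 ∧ x 0 + x 1 ≤ 1}) := by
    rw [convexHull_triple_eq]
    rintro _ ⟨s, t, hs, ht, hst, rfl⟩
    refine ⟨!₂[s, t], by simpa using ⟨hs, ht, hst⟩, ?_⟩
    rw [happ]; simp
  refine (measure_mono hsub).trans ?_
  rw [measure_preimage_add, Measure.addHaar_image_linearMap, hdet]
  refine (mul_le_mul_right volume_standard_triangle_le _).trans ?_
  rw [← ENNReal.ofReal_mul (abs_nonneg _)]
  apply ENNReal.ofReal_le_ofReal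
  linarith

/-- A triangle with vertices in a disk of squared radius `M` has at most the area of the
inscribed equilateral triangle. -/
lemma volume_convexHull_triple_le_of_dist {a b c p : Euc2} {M : ℝ} (ha : dist a p ^ 2 ≤ M)
    (hb : dist b p ^ 2 ≤ M) (hc : dist c p ^ 2 ≤ M) :
    volume (convexHull ℝ {a, b, c}) ≤ ENNReal.ofReal (3 * Real.sqrt 3 / 4 * M) := by
  refine (volume_convexHull_triple_le a b c).trans (ENNReal.ofReal_le_ofReal ?_)
  have h3 : Real.sqrt 3 ^ 2 = 3 := Real.sq_sqrt (by norm_num)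
  have h3p : 0 < Real.sqrt 3 := by positivity
  rw [EuclideanSpace.dist_eq, Real.sq_sqrt (by positivity), Fin.sum_univ_two] at ha hb hc
  simp only [Real.dist_eq, sq_abs] at ha hb hc
  set s := Real.sqrt 3
  simp only [planeCross, PiLp.sub_apply]
  generalize a 0 = a0 at *
  generalize a 1 = a1 at *
  generalize b 0 = b0 at *
  generalize b 1 = b1 at *
  generalize c 0 = c0 at *
  generalize c 1 = c1 at *
  generalize p 0 = p0 at *
  generalize p 1 = p1 at *
  obtain ⟨u0, rfl⟩ : ∃ u, a0 = u + p0 := ⟨a0 - p0, by ring⟩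
  obtain ⟨u1, rfl⟩ : ∃ u, a1 = u + p1 := ⟨a1 - p1, by ring⟩
  obtain ⟨v0, rfl⟩ : ∃ u, b0 = u + p0 := ⟨b0 - p0, by ring⟩
  obtain ⟨v1, rfl⟩ : ∃ u, b1 = u + p1 := ⟨b1 - p1, by ring⟩
  obtain ⟨w0, rfl⟩ : ∃ u, c0 = u + p0 := ⟨c0 - p0, by ring⟩
  obtain ⟨w1, rfl⟩ : ∃ u, c1 = u + p1 := ⟨c1 - p1, by ring⟩
  have key : |(v0 + p0 - (u0 + p0)) * (w1 + p1 - (u1 + p1)) -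
      (v1 + p1 - (u1 + p1)) * (w0 + p0 - (u0 + p0))| * s ≤ 3 / 2 * (3 * M) := by
    rw [show ∀ x : ℝ, |x| * s = |x * s| from fun x => by rw [abs_mul, abs_of_pos h3p], abs_le]
    have h1 : 0 ≤ (u0 + v0 + w0) ^ 2 + (u1 + v1 + w1) ^ 2 := by positivity
    have h2 : 0 ≤ (2 * u0 - v0 - w0 - s * (v1 - w1)) ^ 2 +
      (2 * u1 - v1 - w1 + s * (v0 - w0)) ^ 2 := by positivity
    have h4 : 0 ≤ (2 * u0 - v0 - w0 + s * (v1 - w1)) ^ 2 +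
      (2 * u1 - v1 - w1 - s * (v0 - w0)) ^ 2 := by positivity
    have h5 := congrArg (· * ((v1 - w1) ^ 2 + (v0 - w0) ^ 2)) h3
    constructor <;> linarith
  nlinarith [mul_le_mul_of_nonneg_right key h3p.le]

lemma convexHull_triple_rotate (a b c : Euc2) :
    convexHull ℝ ({b, c, a} : Set Euc2) = convexHull ℝ {a, b, c} := by
  congr 1; ext; simp; tauto

/-- The corner of a triangle at a vertex contains all short vectors of the cone there. -/
lemma eventually_cone_subset_corner (a b c : Euc2) (hD : planeCross (b - a) (c - a) ≠ 0) :
    ∀ᶠ δ in nhdsWithin (0 : ℝ) (Set.Ioi 0),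
      {u : Euc2 | 0 ≤ planeCross u (c - a) / planeCross (b - a) (c - a) ∧
        0 ≤ planeCross (b - a) u / planeCross (b - a) (c - a)} ∩ Metric.ball 0 δ ⊆
      (fun u => a + u) ⁻¹' (convexHull ℝ {a, b, c} ∩ Metric.ball a δ) := by
  set D := planeCross (b - a) (c - a) with hDdef
  have hopen : IsOpen {u : Euc2 | planeCross u (c - a) / D + planeCross (b - a) u / D < 1} := by
    refine isOpen_lt ?_ continuous_const
    unfold planeCross
    fun_prop
  obtain ⟨ε, hε, hball⟩ := Metric.isOpen_iff.1 hopen 0 (by simp [planeCross])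
  filter_upwards [Ioo_mem_nhdsGT hε] with δ hδ
  rintro u ⟨⟨h1, h2⟩, hu⟩
  have h3 := hball (Metric.ball_subset_ball hδ.2.le hu)
  refine ⟨?_, by simpa using hu⟩
  rw [convexHull_triple_eq]
  refine ⟨_, _, h1, h2, le_of_lt h3, ?_⟩
  congr 1
  ext i
  rw [PiLp.add_apply, PiLp.smul_apply, PiLp.smul_apply, smul_eq_mul, smul_eq_mul]
  field_simp
  rw [hDdef]
  unfold planeCross
  fin_cases i <;> simp <;> ring

/-- The three corners of a nondegenerate triangle together make up half a disk. -/
lemma eventually_volume_ball_le_corners (a b c : Euc2) (hD : planeCross (b - a) (c - a) ≠ 0) :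
    ∀ᶠ δ in nhdsWithin (0 : ℝ) (Set.Ioi 0),
      volume (Metric.ball (0 : Euc2) δ) ≤ 2 *
        (volume (convexHull ℝ {a, b, c} ∩ Metric.ball a δ) +
          volume (convexHull ℝ {a, b, c} ∩ Metric.ball b δ) +
          volume (convexHull ℝ {a, b, c} ∩ Metric.ball c δ)) := by
  have hDb : planeCross (c - b) (a - b) = planeCross (b - a) (c - a) := by
    simp [planeCross]; ring
  have hDc : planeCross (a - c) (b - c) = planeCross (b - a) (c - a) := by
    simp [planeCross]; ring
  have hb := eventually_cone_subset_corner b c a (hDb ▸ hD)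
  have hc := eventually_cone_subset_corner c a b (hDc ▸ hD)
  rw [hDb, convexHull_triple_rotate] at hb
  rw [hDc, ← convexHull_triple_rotate] at hc
  filter_upwards [eventually_cone_subset_corner a b c hD, hb, hc] with δ hKa hKb hKc
  set H := convexHull ℝ ({a, b, c} : Set Euc2)
  set D := planeCross (b - a) (c - a)
  set E : Euc2 → Set Euc2 := fun v => (fun u => v + u) ⁻¹' (H ∩ Metric.ball v δ) with hE
  have hsub : Metric.ball (0 : Euc2) δ ⊆
      (E a ∪ E b ∪ E c) ∪ (Neg.neg ⁻¹' E a ∪ Neg.neg ⁻¹' E b ∪ Neg.neg ⁻¹' E c) := by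
    intro u hu
    have hu' : -u ∈ Metric.ball (0 : Euc2) δ := by simpa using hu
    have h1 : ∀ v : Euc2, planeCross v (a - b) / D = planeCross (b - a) v / D := by
      intro v; congr 1; simp [planeCross]; ring
    have h2 : ∀ v : Euc2, planeCross (c - b) v / D =
        -(planeCross v (c - a) / D) - planeCross (b - a) v / D := by
      intro v; rw [← neg_div, ← sub_div]; congr 1; simp [planeCross]; ring
    have h3 : ∀ v : Euc2, planeCross v (b - c) / D =
        -(planeCross v (c - a) / D) - planeCross (b - a) v / D := by
      intro v; rw [← neg_div, ← sub_div]; congr 1; simp [planeCross]; ring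
    have h4 : ∀ v : Euc2, planeCross (a - c) v / D = planeCross v (c - a) / D := by
      intro v; congr 1; simp [planeCross]; ring
    have h5 : planeCross (-u) (c - a) / D = -(planeCross u (c - a) / D) := by
      rw [← neg_div]; congr 1; simp [planeCross]; ring
    have h6 : planeCross (b - a) (-u) / D = -(planeCross (b - a) u / D) := by
      rw [← neg_div]; congr 1; simp [planeCross]; ring
    have ha1 := fun h => @hKa u ⟨h, hu⟩
    have ha2 := fun h => @hKa (-u) ⟨h, hu'⟩
    have hb1 := fun h => @hKb u ⟨h, hu⟩
    have hb2 := fun h => @hKb (-u) ⟨h, hu'⟩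
    have hc1 := fun h => @hKc u ⟨h, hu⟩
    have hc2 := fun h => @hKc (-u) ⟨h, hu'⟩
    simp only [Set.mem_ofPred_eq, h1, h2, h3, h4, h5, h6] at ha1 ha2 hb1 hb2 hc1 hc2
    generalize planeCross u (c - a) / D = s at *
    generalize planeCross (b - a) u / D = t at *
    simp only [Set.mem_union]
    rcases le_total 0 s with hs | hs <;> rcases le_total 0 t with ht | ht <;>
      rcases le_total 0 (s + t) with hst | hst
    · exact Or.inl (Or.inl (Or.inl (ha1 ⟨hs, ht⟩)))
    · exact Or.inl (Or.inl (Or.inl (ha1 ⟨hs, ht⟩)))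
    · exact Or.inr (Or.inl (Or.inr (hb2 ⟨by linarith, by linarith⟩)))
    · exact Or.inl (Or.inr (hc1 ⟨by linarith, by linarith⟩))
    · exact Or.inr (Or.inr (hc2 ⟨by linarith, by linarith⟩))
    · exact Or.inl (Or.inl (Or.inr (hb1 ⟨by linarith, by linarith⟩)))
    · exact Or.inr (Or.inl (Or.inl (ha2 ⟨by linarith, by linarith⟩)))
    · exact Or.inr (Or.inl (Or.inl (ha2 ⟨by linarith, by linarith⟩)))
  have hvol : ∀ v, volume (E v) = volume (H ∩ Metric.ball v δ) := fun v =>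
    measure_preimage_add _ _ _
  have hvol' : ∀ v, volume (Neg.neg ⁻¹' E v) = volume (H ∩ Metric.ball v δ) := fun v => by
    rw [Measure.measure_preimage_neg, hvol]
  refine (measure_mono hsub).trans ((measure_union_le _ _).trans ?_)
  rw [two_mul]
  refine add_le_add ?_ ?_
  · refine (measure_union_le _ _).trans (add_le_add ((measure_union_le _ _).trans ?_) ?_)
    · rw [hvol, hvol]
    · rw [hvol]
  · refine (measure_union_le _ _).trans (add_le_add ((measure_union_le _ _).trans ?_) ?_)
    · rw [hvol', hvol']
    · rw [hvol']

/-- `A` is a cell of the weighted Delaunay decomposition of `S` with weights `w` whose power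
level is at most `M`: it consists of all points of `S` of minimal power `m ≤ M` with respect
to some point `p`. -/
def IsDelaunayCell (S : Finset Euc2) (w : Euc2 → ℝ) (M : ℝ) (A : Finset Euc2) : Prop :=
  ∃ (p : Euc2) (m : ℝ), m ≤ M ∧ (∀ c ∈ S, m ≤ dist c p ^ 2 + w c) ∧ A.Nonempty ∧
    ∀ c, c ∈ A ↔ c ∈ S ∧ dist c p ^ 2 + w c = m

lemma dist_sq_sub_dist_sq (y p q : Euc2) :
    dist y p ^ 2 - dist y q ^ 2 = 2 * inner ℝ (q - p) y + (‖p‖ ^ 2 - ‖q‖ ^ 2) := by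
  rw [dist_eq_norm, dist_eq_norm, norm_sub_sq_real, norm_sub_sq_real, inner_sub_left,
    real_inner_comm p, real_inner_comm q]
  ring

lemma IsDelaunayCell.aedisjoint_convexHull {S : Finset Euc2} {w : Euc2 → ℝ} {M : ℝ}
    {A B : Finset Euc2} (hA : IsDelaunayCell S w M A) (hB : IsDelaunayCell S w M B)
    (hAB : A ≠ B) :
    AEDisjoint volume (convexHull ℝ (A : Set Euc2)) (convexHull ℝ (B : Set Euc2)) := by
  obtain ⟨p, m, -, hm, ⟨a, ha⟩, hpA⟩ := hA
  obtain ⟨q, n, -, hn, ⟨b, hb⟩, hqB⟩ := hB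
  have hpq : q - p ≠ 0 := by
    intro h
    obtain rfl : q = p := sub_eq_zero.1 h
    apply hAB
    have h1 := hm b ((hqB b).1 hb).1
    have h2 := hn a ((hpA a).1 ha).1
    have h3 := ((hqB b).1 hb).2
    have h4 := ((hpA a).1 ha).2
    have : m = n := by linarith
    ext c
    rw [hpA, hqB, this]
  set k := (m - n - (‖p‖ ^ 2 - ‖q‖ ^ 2)) / 2 with hk
  have hlin : IsLinearMap ℝ fun y : Euc2 => inner ℝ (q - p) y :=
    (innerSL ℝ (q - p)).toLinearMap.isLinear
  have hAk : convexHull ℝ (A : Set Euc2) ⊆ {y | inner ℝ (q - p) y ≤ k} := by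
    refine convexHull_min (fun c hc => ?_) (convex_halfSpace_le hlin k)
    obtain ⟨hcS, hc⟩ := (hpA c).1 hc
    have := hn c hcS
    have := dist_sq_sub_dist_sq c p q
    simp only [Set.mem_ofPred_eq, hk]
    linarith
  have hBk : convexHull ℝ (B : Set Euc2) ⊆ {y | k ≤ inner ℝ (q - p) y} := by
    refine convexHull_min (fun c hc => ?_) (convex_halfSpace_ge hlin k)
    obtain ⟨hcS, hc⟩ := (hqB c).1 hc
    have := hm c hcS
    have := dist_sq_sub_dist_sq c p q
    simp only [Set.mem_ofPred_eq, hk]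
    linarith
  exact measure_mono_null (fun y hy => le_antisymm (hAk hy.1) (hBk hy.2))
    (volume_setOf_inner_eq hpq k)

/-- Generic small weights leave no Delaunay cell with more than three points. -/
lemma exists_weights_card_le_three (S : Finset Euc2) {ε : ℝ} (hε : 0 < ε) :
    ∃ w : Euc2 → ℝ, (∀ c, 0 ≤ w c ∧ w c ≤ ε) ∧
      ∀ M A, IsDelaunayCell S w M A → A.card ≤ 3 := by
  classical
  obtain ⟨idx, hidx⟩ := Set.countable_iff_exists_injOn.1 S.finite_toSet.countable
  have hrel : ∀ t : Finset Euc2, ∃ f : Euc2 → ℝ, t.card = 4 →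
      ∑ e ∈ t, f e • e = 0 ∧ ∑ e ∈ t, f e = 0 ∧ ∃ x ∈ t, f x ≠ 0 := by
    intro t
    by_cases ht : t.card = 4
    · obtain ⟨f, hf⟩ := Module.exists_nontrivial_relation_sum_zero_of_finrank_succ_lt_card
        (R := ℝ) (t := t) (by rw [finrank_euclideanSpace_fin, ht]; norm_num)
      exact ⟨f, fun _ => hf⟩
    · exact ⟨0, fun h => (ht h).elim⟩
  choose f hf using hrel
  let q : Finset Euc2 → Polynomial ℝ := fun t =>
    ∑ e ∈ t, Polynomial.monomial (idx e + 1) (f t e) +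
      Polynomial.C (∑ e ∈ t, f t e * ‖e‖ ^ 2)
  have hq : ∀ t ∈ S.powersetCard 4, q t ≠ 0 := by
    intro t ht h0
    obtain ⟨htS, htc⟩ := Finset.mem_powersetCard.1 ht
    obtain ⟨-, -, x, hx, hfx⟩ := hf t htc
    apply hfx
    have hc := congrArg (fun r : Polynomial ℝ => r.coeff (idx x + 1)) h0
    simp only [q, Polynomial.coeff_add, Polynomial.finsetSum_coeff, Polynomial.coeff_monomial,
      Polynomial.coeff_C_succ, add_zero, Polynomial.coeff_zero] at hc
    rw [Finset.sum_eq_single x] at hc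
    · simpa using hc
    · intro e he hne
      rw [if_neg]
      intro h
      exact hne (hidx (htS he) (htS hx) (by omega))
    · exact fun h => (h hx).elim
  have hfin : (⋃ t ∈ S.powersetCard 4, {x : ℝ | (q t).IsRoot x}).Finite :=
    Set.Finite.biUnion (Finset.finite_toSet _) fun t ht =>
      Polynomial.finite_setOfPred_isRoot (hq t ht)
  obtain ⟨η, hη, hroot⟩ := (Set.Ioo_infinite (lt_min hε one_pos)).exists_notMem_finite hfin
  have hη1 : η ≤ 1 := (hη.2.trans_le (min_le_right _ _)).le
  have hηε : η ≤ ε := (hη.2.trans_le (min_le_left _ _)).le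
  refine ⟨fun c => η ^ (idx c + 1), fun c => ⟨pow_nonneg hη.1.le _, ?_⟩, ?_⟩
  · exact (pow_le_of_le_one hη.1.le hη1 (Nat.succ_ne_zero _)).trans hηε
  rintro M A ⟨p, m, -, -, -, hA⟩
  by_contra! hcard
  obtain ⟨t, htA, htc⟩ := Finset.exists_subset_card_eq (show 4 ≤ A.card by omega)
  have htS : t ∈ S.powersetCard 4 :=
    Finset.mem_powersetCard.2 ⟨fun c hc => ((hA c).1 (htA hc)).1, htc⟩
  apply hroot
  simp only [Set.mem_iUnion]
  refine ⟨t, htS, ?_⟩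
  obtain ⟨h1, h2, -⟩ := hf t htc
  have hval : ∀ e ∈ t, f t e * η ^ (idx e + 1) + f t e * ‖e‖ ^ 2 =
      f t e * (m - ‖p‖ ^ 2) + 2 * inner ℝ p (f t e • e) := by
    intro e he
    have := ((hA e).1 (htA he)).2
    rw [dist_eq_norm, norm_sub_sq_real, real_inner_comm] at this
    rw [inner_smul_right, ← this]
    ring
  have hsum := Finset.sum_congr rfl hval
  rw [Finset.sum_add_distrib, Finset.sum_add_distrib, ← Finset.sum_mul, ← Finset.mul_sum,
    ← inner_sum, h1, h2] at hsum
  simp only [Set.mem_ofPred_eq, Polynomial.IsRoot.def, q, Polynomial.eval_add,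
    Polynomial.eval_finsetSum, Polynomial.eval_monomial, Polynomial.eval_C]
  simpa using hsum

/-- A point around which `S` is dense enough lies in a Delaunay cell of bounded power. -/
lemma exists_isDelaunayCell_mem_convexHull {S : Finset Euc2} {w : Euc2 → ℝ} {ε R : ℝ}
    (hR : 0 < R) (hε : ε ≤ 1) (hw : ∀ c, 0 ≤ w c ∧ w c ≤ ε) (x : Euc2)
    (hcov : ∀ y ∈ Metric.closedBall x (R + 1), ∃ c ∈ S, dist c y < R) :
    ∃ A, IsDelaunayCell S w (R ^ 2 + ε) A ∧ x ∈ convexHull ℝ (A : Set Euc2) := by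
  classical
  have hxmem : x ∈ Metric.closedBall x (R + 1) := Metric.mem_closedBall_self (by linarith)
  have hne : S.Nonempty := by
    obtain ⟨c, hc, -⟩ := hcov x hxmem
    exact ⟨c, hc⟩
  set φ : Euc2 → Euc2 → ℝ := fun c p => dist c p ^ 2 + w c - dist x p ^ 2 with hφ
  set F : Euc2 → ℝ := fun p => S.inf' hne fun c => φ c p with hF
  have hFcont : Continuous F :=
    Continuous.finset_inf'_apply hne fun c _ => by simp only [hφ]; fun_prop
  obtain ⟨p, hp, hmax⟩ := (isCompact_closedBall x (R + 1)).exists_isMaxOn ⟨x, hxmem⟩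
    hFcont.continuousOn
  have hFx : 0 ≤ F x := by
    refine Finset.le_inf' _ _ fun c _ => ?_
    have := (hw c).1
    simp only [hφ, dist_self]
    nlinarith [sq_nonneg (dist c x)]
  have hFfar : ∀ q ∉ Metric.closedBall x (R + 1), F q < 0 := by
    intro q hq
    rw [Metric.mem_closedBall, not_le, dist_comm] at hq
    have hDpos : 0 < dist x q := by linarith
    set y := AffineMap.lineMap x q ((R + 1) / dist x q) with hy
    have hxy : dist y x = R + 1 := by
      rw [hy, dist_lineMap_left, Real.norm_of_nonneg (by positivity)]
      field_simp
    have hyq : dist y q = dist x q - (R + 1) := by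
      rw [hy, dist_lineMap_right, Real.norm_of_nonneg]
      · field_simp
      · rw [sub_nonneg, div_le_one hDpos]; exact hq.le
    obtain ⟨c, hc, hcy⟩ := hcov y (by rw [Metric.mem_closedBall, hxy])
    refine (Finset.inf'_le _ hc).trans_lt ?_
    have h1 : dist c q < dist x q - 1 := by linarith [dist_triangle c y q]
    have h2 := (hw c).2
    have h3 : dist c q ^ 2 ≤ (dist x q - 1) ^ 2 :=
      pow_le_pow_left₀ dist_nonneg h1.le 2
    simp only [hφ]
    nlinarith
  have hglob : ∀ q, F q ≤ F p := by
    intro q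
    by_cases hq : q ∈ Metric.closedBall x (R + 1)
    · exact hmax hq
    · exact (hFfar q hq).le.trans (hFx.trans (hmax hxmem))
  set m := F p + dist x p ^ 2 with hm
  set A := S.filter fun c => dist c p ^ 2 + w c = m with hA
  have hmin : ∀ c ∈ S, F p ≤ φ c p := fun c hc => Finset.inf'_le _ hc
  refine ⟨A, ⟨p, m, ?_, fun c hc => ?_, ?_, fun c => by rw [hA, Finset.mem_filter]⟩, ?_⟩
  · obtain ⟨c, hc, hcp⟩ := hcov p hp
    have h1 := hmin c hc
    have h2 := (hw c).2
    have h3 : dist c p ^ 2 ≤ R ^ 2 := pow_le_pow_left₀ dist_nonneg hcp.le 2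
    simp only [hφ] at h1
    linarith
  · have h1 := hmin c hc
    simp only [hφ] at h1
    linarith
  · obtain ⟨c, hc, hce⟩ := Finset.exists_mem_eq_inf' hne fun c => φ c p
    refine ⟨c, Finset.mem_filter.2 ⟨hc, ?_⟩⟩
    have : F p = φ c p := hce
    simp only [hφ] at this
    linarith
  · by_contra hx
    obtain ⟨f, u, hfx, hfA⟩ := geometric_hahn_banach_point_closed (convex_convexHull ℝ _)
      (A.finite_toSet.isCompact_convexHull ℝ).isClosed hx
    set v := (InnerProductSpace.toDual ℝ Euc2).symm f with hv
    have hfv : ∀ y, f y = inner ℝ v y := fun y => by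
      rw [hv, InnerProductSpace.toDual_symm_apply]
    have hshift : ∀ c t, φ c (p - t • v) = φ c p + t * (2 * (f c - f x)) := by
      intro c t
      simp only [hφ, hfv]
      have h1 := dist_sq_sub_dist_sq c (p - t • v) p
      have h2 := dist_sq_sub_dist_sq x (p - t • v) p
      rw [sub_sub_cancel, inner_smul_left] at h1 h2
      simp only [conj_trivial] at h1 h2
      linarith
    have hev : ∀ c ∈ S, ∀ᶠ t in nhdsWithin (0 : ℝ) (Set.Ioi 0), F p < φ c (p - t • v) := by
      intro c hc
      simp only [hshift]
      by_cases hcA : c ∈ A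
      · have h1 := hfA c (subset_convexHull ℝ _ hcA)
        filter_upwards [self_mem_nhdsWithin] with t ht
        have h2 : 0 < t * (2 * (f c - f x)) := mul_pos ht (by linarith)
        linarith [hmin c hc]
      · have hlt : F p < φ c p := by
          refine lt_of_le_of_ne (hmin c hc) fun h => hcA (Finset.mem_filter.2 ⟨hc, ?_⟩)
          simp only [hφ] at h
          linarith
        have hcont : Continuous fun t : ℝ => φ c p + t * (2 * (f c - f x)) := by fun_prop
        exact nhdsWithin_le_nhds (hcont.continuousAt.eventually_const_lt (by simpa using hlt))
    obtain ⟨t, ht⟩ := ((Filter.eventually_all_finset S).2 hev).exists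
    have : F p < F (p - t • v) := (Finset.lt_inf'_iff _).2 ht
    exact this.not_ge (hglob _)

lemma IsDelaunayCell.subset {S : Finset Euc2} {w : Euc2 → ℝ} {M : ℝ} {A : Finset Euc2}
    (hA : IsDelaunayCell S w M A) : A ⊆ S := by
  obtain ⟨p, m, -, -, -, h⟩ := hA
  exact fun c hc => ((h c).1 hc).1

lemma volume_convexHull_triple_eq_zero {a b c : Euc2} (h : planeCross (b - a) (c - a) = 0) :
    volume (convexHull ℝ {a, b, c}) = 0 := by
  simpa [h] using volume_convexHull_triple_le a b c

lemma exists_triple_of_card_le_three {A : Finset Euc2} (hne : A.Nonempty) (hA : A.card ≤ 3) :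
    ∃ a b c : Euc2, (A : Set Euc2) = {a, b, c} := by
  classical
  have := hne.card_pos
  interval_cases h : A.card
  · obtain ⟨a, rfl⟩ := Finset.card_eq_one.1 h
    exact ⟨a, a, a, by simp⟩
  · obtain ⟨a, b, -, rfl⟩ := Finset.card_eq_two.1 h
    exact ⟨a, a, b, by simp⟩
  · obtain ⟨a, b, c, -, -, -, rfl⟩ := Finset.card_eq_three.1 h
    exact ⟨a, b, c, by simp⟩

/-- Finitely many triangles with vertices in `S` and without overlap number at most
`2 * S.card`. -/
lemma card_triangles_le (S : Finset Euc2) (𝒯 : Finset (Finset Euc2))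
    (hS : ∀ A ∈ 𝒯, A ⊆ S) (hne : ∀ A ∈ 𝒯, A.Nonempty) (hcard : ∀ A ∈ 𝒯, A.card ≤ 3)
    (hvol : ∀ A ∈ 𝒯, volume (convexHull ℝ (A : Set Euc2)) ≠ 0)
    (hdisj : (𝒯 : Set (Finset Euc2)).Pairwise
      (Function.onFun (AEDisjoint volume) fun A => convexHull ℝ (A : Set Euc2))) :
    𝒯.card ≤ 2 * S.card := by
  classical
  have hcorner : ∀ A ∈ 𝒯, ∀ᶠ δ in nhdsWithin (0 : ℝ) (Set.Ioi 0),
      volume (Metric.ball (0 : Euc2) δ) ≤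
        2 * ∑ v ∈ S, volume (convexHull ℝ (A : Set Euc2) ∩ Metric.ball v δ) := by
    intro A hA
    obtain ⟨a, b, c, habc⟩ := exists_triple_of_card_le_three (hne A hA) (hcard A hA)
    have hv := hvol A hA
    rw [habc] at hv
    have hD : planeCross (b - a) (c - a) ≠ 0 := mt volume_convexHull_triple_eq_zero hv
    have hab : a ≠ b := by rintro rfl; simp [planeCross] at hD
    have hac : a ≠ c := by rintro rfl; simp [planeCross] at hD
    have hbc : b ≠ c := by rintro rfl; apply hD; simp only [planeCross]; ring
    filter_upwards [eventually_volume_ball_le_corners a b c hD] with δ hδ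
    refine hδ.trans ?_
    rw [habc]
    gcongr
    have hsub : ({a, b, c} : Finset Euc2) ⊆ S := by
      refine Finset.Subset.trans ?_ (hS A hA)
      rw [← Finset.coe_subset, habc]; simp
    refine le_trans (le_of_eq ?_) (Finset.sum_le_sum_of_subset hsub)
    rw [Finset.sum_insert (by simp [hab, hac]), Finset.sum_pair hbc, add_assoc]
  obtain ⟨δ, hδ, hδ0⟩ :=
    (((Filter.eventually_all_finset 𝒯).2 hcorner).and self_mem_nhdsWithin).exists
  set β := volume (Metric.ball (0 : Euc2) δ) with hβ
  have hvertex : ∀ v : Euc2,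
      ∑ A ∈ 𝒯, volume (convexHull ℝ (A : Set Euc2) ∩ Metric.ball v δ) ≤ β := by
    intro v
    rw [← measure_biUnion_finset₀]
    · refine (measure_mono ?_).trans_eq (Measure.addHaar_ball_center volume v δ)
      exact Set.iUnion₂_subset fun A _ => Set.inter_subset_right
    · intro A hA B hB hAB
      exact (hdisj hA hB hAB).mono Set.inter_subset_left Set.inter_subset_left
    · intro A _
      exact ((A.finite_toSet.isCompact_convexHull ℝ).measurableSet.inter
        measurableSet_ball).nullMeasurableSet
  have hle : (𝒯.card : ENNReal) * β ≤ (2 * S.card : ENNReal) * β := by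
    calc (𝒯.card : ENNReal) * β = ∑ A ∈ 𝒯, β := by rw [Finset.sum_const, nsmul_eq_mul]
      _ ≤ ∑ A ∈ 𝒯, 2 * ∑ v ∈ S, volume (convexHull ℝ (A : Set Euc2) ∩ Metric.ball v δ) :=
        Finset.sum_le_sum hδ
      _ = 2 * ∑ v ∈ S, ∑ A ∈ 𝒯, volume (convexHull ℝ (A : Set Euc2) ∩ Metric.ball v δ) := by
        rw [← Finset.mul_sum, Finset.sum_comm]
      _ ≤ 2 * ∑ v ∈ S, β := by gcongr with v _; exact hvertex v
      _ = (2 * S.card : ENNReal) * β := by rw [Finset.sum_const, nsmul_eq_mul, mul_assoc]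
  have hβ0 : β ≠ 0 := (Metric.measure_ball_pos volume 0 hδ0).ne'
  have hβtop : β ≠ ⊤ := measure_ball_lt_top.ne
  rw [ENNReal.mul_le_mul_iff_left hβ0 hβtop] at hle
  exact_mod_cast hle

/-- Kershner's bound for disks of radius `R` that cover a neighbourhood of a disk of
radius `r`. -/
lemma kershner_bound {S : Finset Euc2} {r R : ℝ} (hr : 0 ≤ r) (hR : 0 < R)
    (hcov : ∀ y ∈ Metric.closedBall (0 : Euc2) (r + R + 1), ∃ c ∈ S, dist c y < R) :
    Real.pi * r ^ 2 ≤ 3 * Real.sqrt 3 / 2 * R ^ 2 * S.card := by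
  classical
  have hkey : ∀ ε ∈ Set.Ioc (0 : ℝ) 1,
      Real.pi * r ^ 2 ≤ 3 * Real.sqrt 3 / 4 * (R ^ 2 + ε) * (2 * S.card) := by
    intro ε hε
    obtain ⟨w, hw, hcard⟩ := exists_weights_card_le_three S hε.1
    set M := R ^ 2 + ε with hM
    have hM0 : 0 < M := add_pos (pow_pos hR 2) hε.1
    set 𝒟 := S.powerset.filter fun A => IsDelaunayCell S w M A with h𝒟
    set 𝒯 := 𝒟.filter fun A : Finset Euc2 => volume (convexHull ℝ (A : Set Euc2)) ≠ 0 with h𝒯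
    have hcell : ∀ A ∈ 𝒟, IsDelaunayCell S w M A := fun A hA => (Finset.mem_filter.1 hA).2
    have hcellT : ∀ A ∈ 𝒯, IsDelaunayCell S w M A := fun A hA =>
      hcell A (Finset.mem_filter.1 hA).1
    have hne : ∀ A, IsDelaunayCell S w M A → A.Nonempty := fun A ⟨_, _, _, _, h, _⟩ => h
    have hcover : Metric.ball (0 : Euc2) r ⊆ ⋃ A ∈ 𝒟, convexHull ℝ (A : Set Euc2) := by
      intro x hx
      obtain ⟨A, hA, hxA⟩ := exists_isDelaunayCell_mem_convexHull hR hε.2 hw x fun y hy =>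
        hcov y (by
          rw [mem_ball_zero_iff] at hx
          rw [mem_closedBall_zero_iff]
          rw [Metric.mem_closedBall, dist_eq_norm] at hy
          linarith [norm_sub_norm_le y x])
      exact Set.mem_biUnion (Finset.mem_filter.2 ⟨Finset.mem_powerset.2 hA.subset, hA⟩) hxA
    have harea : ∀ A ∈ 𝒯, volume (convexHull ℝ (A : Set Euc2)) ≤
        ENNReal.ofReal (3 * Real.sqrt 3 / 4 * M) := by
      intro A hA
      obtain ⟨a, b, c, habc⟩ := exists_triple_of_card_le_three (hne A (hcellT A hA))
        (hcard M A (hcellT A hA))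
      obtain ⟨p, m, hm, -, -, hmem⟩ := hcellT A hA
      have hdist : ∀ d ∈ ({a, b, c} : Set Euc2), dist d p ^ 2 ≤ M := by
        intro d hd
        have := ((hmem d).1 (by rw [← Finset.mem_coe, habc]; exact hd)).2
        linarith [(hw d).1]
      rw [habc]
      exact volume_convexHull_triple_le_of_dist (hdist a (by simp)) (hdist b (by simp))
        (hdist c (by simp))
    have hcount : 𝒯.card ≤ 2 * S.card :=
      card_triangles_le S 𝒯 (fun A hA => (hcellT A hA).subset)
        (fun A hA => hne A (hcellT A hA)) (fun A hA => hcard M A (hcellT A hA))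
        (fun A hA => (Finset.mem_filter.1 hA).2)
        (fun A hA B hB hAB => (hcellT A hA).aedisjoint_convexHull (hcellT B hB) hAB)
    have hvol : ENNReal.ofReal (Real.pi * r ^ 2) ≤
        ENNReal.ofReal (3 * Real.sqrt 3 / 4 * M * (2 * S.card)) := by
      calc ENNReal.ofReal (Real.pi * r ^ 2) = volume (Metric.ball (0 : Euc2) r) := by
            rw [EuclideanSpace.volume_ball_fin_two, mul_comm, ENNReal.ofReal_mul (by positivity),
              ENNReal.ofReal_pow hr]
        _ ≤ ∑ A ∈ 𝒟, volume (convexHull ℝ (A : Set Euc2)) :=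
            (measure_mono hcover).trans (measure_biUnion_finset_le _ _)
        _ = ∑ A ∈ 𝒯, volume (convexHull ℝ (A : Set Euc2)) := (Finset.sum_filter_ne_zero _).symm
        _ ≤ ∑ A ∈ 𝒯, ENNReal.ofReal (3 * Real.sqrt 3 / 4 * M) := Finset.sum_le_sum harea
        _ = ENNReal.ofReal (3 * Real.sqrt 3 / 4 * M * 𝒯.card) := by
            rw [Finset.sum_const, nsmul_eq_mul, mul_comm,
              ENNReal.ofReal_mul (q := (𝒯.card : ℝ)) (by positivity), ENNReal.ofReal_natCast]
        _ ≤ ENNReal.ofReal (3 * Real.sqrt 3 / 4 * M * (2 * S.card)) := by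
            apply ENNReal.ofReal_le_ofReal
            gcongr
            exact_mod_cast hcount
    exact (ENNReal.ofReal_le_ofReal_iff (by positivity)).1 hvol
  have hlim : Filter.Tendsto (fun ε : ℝ => 3 * Real.sqrt 3 / 4 * (R ^ 2 + ε) * (2 * S.card))
      (nhdsWithin 0 (Set.Ioi 0)) (nhds (3 * Real.sqrt 3 / 4 * (R ^ 2 + 0) * (2 * S.card))) :=
    Filter.Tendsto.mono_left (Continuous.tendsto (by fun_prop) _) nhdsWithin_le_nhds
  refine (ge_of_tendsto hlim (Filter.mem_of_superset (Ioc_mem_nhdsGT one_pos) hkey)).trans_eq ?_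
  ring

lemma disjoint_interior_unit_closedBall_iff (x y : Euc2) :
    Disjoint (interior (Metric.closedBall x 1)) (interior (Metric.closedBall y 1)) ↔
      2 ≤ dist x y := by
  rw [interior_closedBall _ one_ne_zero, interior_closedBall _ one_ne_zero,
    disjoint_ball_ball_iff one_pos one_pos]
  norm_num

lemma volume_euc2_ball (x : Euc2) {r : ℝ} (hr : 0 ≤ r) :
    volume (Metric.ball x r) = ENNReal.ofReal (Real.pi * r ^ 2) := by
  rw [EuclideanSpace.volume_ball_fin_two, mul_comm, ENNReal.ofReal_mul (by positivity),
    ENNReal.ofReal_pow hr]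

lemma IsSaturatedDiskPacking.le_densityIn {P : Set (Set Euc2)} (hP : IsSaturatedDiskPacking P)
    {r : ℝ} (hr : 6 < r) :
    ENNReal.ofReal (Real.pi / (6 * Real.sqrt 3) * ((r - 6) / r) ^ 2) ≤ densityIn P r := by
  classical
  obtain ⟨⟨hdisk, -⟩, hsat⟩ := hP
  have hcen : ∀ L : P, ∃ x : Euc2, (L : Set Euc2) = Metric.closedBall x 1 := fun L =>
    hdisk L L.2
  choose cen hcen using hcen
  have hcov : ∀ y : Euc2, ∃ L : P, dist (cen L) y < 2 := by
    intro y
    by_contra! h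
    refine hsat ⟨y, fun M hM => ?_⟩
    rw [show M = _ from hcen ⟨M, hM⟩, disjoint_interior_unit_closedBall_iff, dist_comm]
    exact h _
  obtain ⟨b, hb, hbfin, hbcov⟩ :=
    (isCompact_closedBall (0 : Euc2) (r - 6 + 2 + 1)).elim_finite_subcover_image
      (b := {L : P | ‖cen L‖ < r - 1}) (c := fun L => Metric.ball (cen L) 2)
      (fun _ _ => Metric.isOpen_ball) (by
        intro y hy
        obtain ⟨L, hL⟩ := hcov y
        refine Set.mem_biUnion (x := L) ?_ (by rwa [Metric.mem_ball, dist_comm])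
        rw [mem_closedBall_zero_iff] at hy
        rw [dist_eq_norm] at hL
        have := norm_sub_norm_le (cen L) y
        simp only [Set.mem_ofPred_eq]
        linarith)
  set S := hbfin.toFinset.image cen with hS
  have hker := kershner_bound (S := S) (r := r - 6) (R := 2) (by linarith) two_pos (by
    intro y hy
    obtain ⟨L, hL, hyL⟩ := Set.mem_iUnion₂.1 (hbcov hy)
    exact ⟨cen L, Finset.mem_image_of_mem _ (hbfin.mem_toFinset.2 hL), by
      rwa [dist_comm]⟩)
  have hcard : (S.card : ℝ) ≤ hbfin.toFinset.card := by exact_mod_cast Finset.card_image_le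
  have hsum : ENNReal.ofReal (Real.pi * S.card) ≤
      ∑' L : P, volume ((L : Set Euc2) ∩ Metric.ball 0 r) := by
    calc ENNReal.ofReal (Real.pi * S.card) ≤
        ENNReal.ofReal (Real.pi * hbfin.toFinset.card) := by gcongr
      _ = ∑ L ∈ hbfin.toFinset, ENNReal.ofReal (Real.pi * 1 ^ 2) := by
        rw [Finset.sum_const, nsmul_eq_mul, mul_comm Real.pi, ENNReal.ofReal_mul (by positivity),
          ENNReal.ofReal_natCast, one_pow, mul_one]
      _ ≤ ∑ L ∈ hbfin.toFinset, volume ((L : Set Euc2) ∩ Metric.ball 0 r) := by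
        refine Finset.sum_le_sum fun L hL => ?_
        rw [← volume_euc2_ball (cen L) zero_le_one, hcen L]
        refine measure_mono (Set.subset_inter Metric.ball_subset_closedBall fun x hx => ?_)
        have h1 : ‖cen L‖ < r - 1 := hb (hbfin.mem_toFinset.1 hL)
        rw [Metric.mem_ball, dist_eq_norm] at hx
        rw [mem_ball_zero_iff]
        linarith [norm_sub_norm_le x (cen L)]
      _ ≤ ∑' L : P, volume ((L : Set Euc2) ∩ Metric.ball 0 r) := ENNReal.sum_le_tsum _
  refine le_trans ?_ (ENNReal.div_le_div_right hsum _)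
  have hr0 : 0 < r := by linarith
  rw [volume_euc2_ball 0 hr0.le, ← ENNReal.ofReal_div_of_pos (by positivity)]
  apply ENNReal.ofReal_le_ofReal
  rw [mul_div_mul_left _ _ Real.pi_ne_zero, div_pow, ← mul_div_assoc]
  gcongr
  rw [div_mul_eq_mul_div, div_le_iff₀ (by positivity)]
  linarith

lemma tendsto_density_bound (k : ℝ) :
    Filter.Tendsto (fun r : ℝ => ENNReal.ofReal (Real.pi / (6 * Real.sqrt 3) * ((r + k) / r) ^ 2))
      Filter.atTop (nhds (ENNReal.ofReal (Real.pi / (6 * Real.sqrt 3)))) := by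
  have h1 : Filter.Tendsto (fun r : ℝ => 1 + k / r) Filter.atTop (nhds (1 + 0)) :=
    (tendsto_const_nhds.div_atTop Filter.tendsto_id).const_add 1
  have h2 := ((h1.pow 2).const_mul (Real.pi / (6 * Real.sqrt 3)))
  simp only [add_zero, one_pow, mul_one] at h2
  refine ENNReal.tendsto_ofReal (h2.congr' ?_)
  filter_upwards [Filter.eventually_gt_atTop 0] with r hr
  rw [add_div, div_self hr.ne']

lemma IsSaturatedDiskPacking.le_lowerDensity {P : Set (Set Euc2)}
    (hP : IsSaturatedDiskPacking P) :
    ENNReal.ofReal (Real.pi / (6 * Real.sqrt 3)) ≤ lowerDensity P := by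
  rw [← (tendsto_density_bound (-6)).liminf_eq]
  refine Filter.liminf_le_liminf ?_
  filter_upwards [Filter.eventually_gt_atTop 6] with r hr
  exact hP.le_densityIn hr

/-- A strict contraction of the line that moves every point by a bounded amount. -/
def shrink (t : ℝ) : ℝ := t - Real.arctan t / 4

lemma abs_arctan_sub_arctan_le (s t : ℝ) : |Real.arctan s - Real.arctan t| ≤ |s - t| := by
  have := convex_univ.norm_image_sub_le_of_norm_deriv_le (f := Real.arctan) (C := 1)
    (x := t) (y := s) (fun x _ => Real.differentiableAt_arctan x) (fun x _ => by
      rw [Real.deriv_arctan, Real.norm_of_nonneg (by positivity), div_le_one (by positivity)]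
      nlinarith [sq_nonneg x]) trivial trivial
  simpa using this

lemma abs_shrink_sub_self_le (t : ℝ) : |shrink t - t| ≤ 1 / 2 := by
  have h1 := Real.arctan_lt_pi_div_two t
  have h2 := Real.neg_pi_div_two_lt_arctan t
  have h3 := Real.pi_le_four
  rw [shrink, abs_le]
  constructor <;> linarith

lemma le_abs_shrink_sub (s t : ℝ) : 3 / 4 * |s - t| ≤ |shrink s - shrink t| := by
  have h := abs_arctan_sub_arctan_le s t
  have : shrink s - shrink t = (s - t) - (Real.arctan s - Real.arctan t) / 4 := by
    simp only [shrink]; ring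
  rw [this]
  have h1 := abs_sub_abs_le_abs_sub (s - t) ((Real.arctan s - Real.arctan t) / 4)
  rw [abs_div, abs_of_pos (four_pos : (0 : ℝ) < 4)] at h1
  linarith

lemma sq_shrink_sub_lt {s t : ℝ} (hst : s ≠ t) : (shrink s - shrink t) ^ 2 < (s - t) ^ 2 := by
  have h := abs_arctan_sub_arctan_le s t
  rw [sq_lt_sq]
  wlog hlt : t < s generalizing s t
  · rw [abs_sub_comm, abs_sub_comm s]
    exact this hst.symm (by rwa [abs_sub_comm, abs_sub_comm t])
      (lt_of_le_of_ne (not_lt.1 hlt) hst)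
  have h1 := Real.arctan_strictMono hlt
  rw [abs_of_pos (sub_pos.2 h1), abs_of_pos (sub_pos.2 hlt)] at h
  rw [abs_of_pos (sub_pos.2 hlt), abs_lt]
  simp only [shrink]
  constructor <;> linarith

lemma shrink_surjective : Function.Surjective shrink := by
  have hc : Continuous shrink := by unfold shrink; fun_prop
  refine hc.surjective ?_ ?_
  · refine Filter.tendsto_atTop_mono (fun t => ?_)
      (Filter.tendsto_atTop_add_const_right _ (-(1 / 2)) Filter.tendsto_id)
    have := (abs_le.1 (abs_shrink_sub_self_le t)).1
    simp only [id]; linarith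
  · refine Filter.tendsto_atBot_mono (fun t => ?_)
      (Filter.tendsto_atBot_add_const_right _ (1 / 2) Filter.tendsto_id)
    have := (abs_le.1 (abs_shrink_sub_self_le t)).2
    simp only [id]; linarith

/-- The points of the triangular lattice with covering radius `2`, contracted by `shrink`. -/
def shrunkLattice (ij : ℤ × ℤ) : Euc2 :=
  !₂[shrink (Real.sqrt 3 * (2 * ij.1 + ij.2)), shrink (3 * ij.2)]

lemma two_le_dist_shrunkLattice {u v : ℤ × ℤ} (huv : u ≠ v) :
    2 ≤ dist (shrunkLattice u) (shrunkLattice v) := by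
  obtain ⟨i, j⟩ := u
  obtain ⟨k, l⟩ := v
  rw [EuclideanSpace.dist_eq, Fin.sum_univ_two]
  apply Real.le_sqrt_of_sq_le
  simp only [shrunkLattice, Real.dist_eq, sq_abs, PiLp.toLp_apply, Matrix.cons_val_zero,
    Matrix.cons_val_one]
  have h0 := le_abs_shrink_sub (Real.sqrt 3 * (2 * i + j)) (Real.sqrt 3 * (2 * k + l))
  have h1 := le_abs_shrink_sub (3 * j) (3 * l)
  have hone : ∀ m : ℤ, m ≠ 0 → (1 : ℝ) ≤ |(m : ℝ)| := fun m hm => by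
    exact_mod_cast Int.one_le_abs hm
  by_cases hjl : j = l
  · subst hjl
    have hik : i - k ≠ 0 := fun h => huv (by rw [sub_eq_zero.1 h])
    have h2 := hone _ hik
    rw [show Real.sqrt 3 * (2 * (i : ℝ) + j) - Real.sqrt 3 * (2 * k + j) =
      2 * Real.sqrt 3 * ((i - k : ℤ) : ℝ) by push_cast; ring, abs_mul,
      abs_of_pos (by positivity)] at h0
    have h3 : (1.7 : ℝ) ≤ Real.sqrt 3 := Real.le_sqrt_of_sq_le (by norm_num)
    have h4 : (2 : ℝ) ≤ |shrink (Real.sqrt 3 * (2 * i + j)) - shrink (Real.sqrt 3 * (2 * k + j))| := by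
      nlinarith
    rw [← sq_abs (shrink (Real.sqrt 3 * _) - _)]
    nlinarith [sq_nonneg (shrink (3 * (j : ℝ)) - shrink (3 * j))]
  · have h2 := hone _ (sub_ne_zero.2 hjl)
    rw [show 3 * (j : ℝ) - 3 * l = 3 * ((j - l : ℤ) : ℝ) by push_cast; ring, abs_mul,
      abs_of_pos three_pos] at h1
    have h4 : (2 : ℝ) ≤ |shrink (3 * (j : ℝ)) - shrink (3 * l)| := by linarith
    rw [← sq_abs (shrink (3 * (j : ℝ)) - _)]
    nlinarith [sq_nonneg (shrink (Real.sqrt 3 * (2 * i + j)) - shrink (Real.sqrt 3 * (2 * k + l)))]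

/-- The triangular lattice with side `2√3` has covering radius at most `2`. -/
lemma exists_lattice_point_near (x y : ℝ) :
    ∃ i j : ℤ, (x - Real.sqrt 3 * (2 * i + j)) ^ 2 + (y - 3 * j) ^ 2 ≤ 4 := by
  have h3 : Real.sqrt 3 ^ 2 = 3 := Real.sq_sqrt (by norm_num)
  have hpos : 0 < Real.sqrt 3 := by positivity
  set m := ⌊x / Real.sqrt 3⌋ with hm
  set j := ⌊y / 3⌋ with hj
  obtain ⟨s, hs⟩ : ∃ s, x = Real.sqrt 3 * (m + s) := ⟨x / Real.sqrt 3 - m, by field_simp; ring⟩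
  obtain ⟨t, ht⟩ : ∃ t, y = 3 * (j + t) := ⟨y / 3 - j, by ring⟩
  have hs' : s = x / Real.sqrt 3 - m := by rw [hs]; field_simp; ring
  have ht' : t = y / 3 - j := by rw [ht]; ring
  have hs0 : 0 ≤ s := by rw [hs']; linarith [Int.floor_le (x / Real.sqrt 3)]
  have hs1 : s ≤ 1 := by rw [hs']; linarith [Int.lt_floor_add_one (x / Real.sqrt 3)]
  have ht0 : 0 ≤ t := by rw [ht']; linarith [Int.floor_le (y / 3)]
  have ht1 : t ≤ 1 := by rw [ht']; linarith [Int.lt_floor_add_one (y / 3)]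
  have corner : ∀ s t : ℝ, 0 ≤ s → s ≤ 1 → 0 ≤ t → t ≤ 1 → s + 3 * t ≤ 2 →
      3 * s ^ 2 + 9 * t ^ 2 ≤ 4 := by
    intro s t hs0 hs1 ht0 ht1 h
    nlinarith [mul_nonneg hs0 (sub_nonneg.2 hs1), mul_nonneg ht0 (sub_nonneg.2 h),
      mul_nonneg hs0 ht0]
  have hval : ∀ a b : ℝ, (Real.sqrt 3 * a) ^ 2 + (3 * b) ^ 2 = 3 * a ^ 2 + 9 * b ^ 2 := by
    intro a b; rw [mul_pow, h3]; ring
  have key : ∀ (p q : ℤ) (i : ℤ), m + p = 2 * i + (j + q) →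
      3 * (s - p) ^ 2 + 9 * (t - q) ^ 2 ≤ 4 →
      ∃ i j : ℤ, (x - Real.sqrt 3 * (2 * i + j)) ^ 2 + (y - 3 * j) ^ 2 ≤ 4 := by
    intro p q i hi hle
    refine ⟨i, j + q, ?_⟩
    have hi' : (m : ℝ) + p = 2 * i + (j + q) := by exact_mod_cast hi
    rw [← hval] at hle
    convert hle using 3
    · rw [hs]; push_cast; rw [← hi']; ring
    · rw [ht]; push_cast; ring
  clear_value m j
  rcases Int.even_or_odd' (m - j) with ⟨i, hi | hi⟩
  · rcases le_total (s + 3 * t) 2 with h | h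
    · refine key 0 0 i (by omega) ?_
      simpa using corner s t hs0 hs1 ht0 ht1 h
    · refine key 1 1 i (by omega) ?_
      have := corner (1 - s) (1 - t) (by linarith) (by linarith) (by linarith) (by linarith)
        (by linarith)
      push_cast
      linarith
  · rcases le_total (1 - s + 3 * t) 2 with h | h
    · refine key 1 0 (i + 1) (by omega) ?_
      have := corner (1 - s) t (by linarith) (by linarith) ht0 ht1 h
      push_cast
      linarith
    · refine key 0 1 i (by omega) ?_
      have := corner s (1 - t) hs0 hs1 (by linarith) (by linarith) (by linarith)
      push_cast
      linarith

lemma exists_dist_shrunkLattice_lt (y : Euc2) : ∃ u, dist y (shrunkLattice u) < 2 := by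
  obtain ⟨a, ha⟩ := shrink_surjective (y 0)
  obtain ⟨b, hb⟩ := shrink_surjective (y 1)
  obtain ⟨i, j, hij⟩ := exists_lattice_point_near a b
  refine ⟨(i, j), ?_⟩
  rw [EuclideanSpace.dist_eq, Fin.sum_univ_two, Real.sqrt_lt' two_pos]
  simp only [shrunkLattice, Real.dist_eq, sq_abs, PiLp.toLp_apply, Matrix.cons_val_zero,
    Matrix.cons_val_one, ← ha, ← hb]
  generalize Real.sqrt 3 * (2 * (i : ℝ) + j) = c at *
  generalize 3 * (j : ℝ) = d at *
  by_cases hac : a = c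
  · by_cases hbd : b = d
    · subst hac hbd; norm_num
    · have := sq_shrink_sub_lt hbd
      subst hac
      nlinarith
  · have h1 := sq_shrink_sub_lt hac
    by_cases hbd : b = d
    · subst hbd
      nlinarith
    · linarith [sq_shrink_sub_lt hbd]

lemma isSaturatedDiskPacking_shrunkLattice :
    IsSaturatedDiskPacking (Set.range fun u => Metric.closedBall (shrunkLattice u) 1) := by
  refine ⟨⟨?_, ?_⟩, ?_⟩
  · rintro _ ⟨u, rfl⟩
    exact ⟨_, rfl⟩
  · rintro _ ⟨u, rfl⟩ _ ⟨v, rfl⟩ huv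
    rw [disjoint_interior_unit_closedBall_iff]
    exact two_le_dist_shrunkLattice fun h => huv (by rw [h])
  · rintro ⟨x, hx⟩
    obtain ⟨u, hu⟩ := exists_dist_shrunkLattice_lt x
    exact hu.not_ge ((disjoint_interior_unit_closedBall_iff _ _).1 (hx _ ⟨u, rfl⟩))

/-- A rectangle of the area of a fundamental cell of the triangular lattice. -/
def latticeBrick (ij : ℤ × ℤ) : Set Euc2 :=
  WithLp.ofLp ⁻¹' Set.pi Set.univ fun k =>
    Set.Ico ((![Real.sqrt 3 * (2 * ij.1 + ij.2), 3 * ij.2] : Fin 2 → ℝ) k)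
      ((![Real.sqrt 3 * (2 * ij.1 + ij.2) + 2 * Real.sqrt 3, 3 * ij.2 + 3] : Fin 2 → ℝ) k)

lemma mem_latticeBrick {ij : ℤ × ℤ} {x : Euc2} :
    x ∈ latticeBrick ij ↔
      (Real.sqrt 3 * (2 * ij.1 + ij.2) ≤ x 0 ∧
        x 0 < Real.sqrt 3 * (2 * ij.1 + ij.2) + 2 * Real.sqrt 3) ∧
      (3 * ij.2 ≤ x 1 ∧ x 1 < 3 * ij.2 + 3) := by
  simp [latticeBrick, Set.mem_pi, Fin.forall_fin_two]

lemma measurableSet_latticeBrick (ij : ℤ × ℤ) : MeasurableSet (latticeBrick ij) :=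
  (PiLp.volume_preserving_ofLp (Fin 2)).measurable
    (MeasurableSet.univ_pi fun _ => measurableSet_Ico)

lemma volume_latticeBrick (ij : ℤ × ℤ) :
    volume (latticeBrick ij) = ENNReal.ofReal (6 * Real.sqrt 3) := by
  rw [latticeBrick, (PiLp.volume_preserving_ofLp (Fin 2)).measure_preimage
    (MeasurableSet.univ_pi fun _ => measurableSet_Ico).nullMeasurableSet, Real.volume_pi_Ico,
    Fin.prod_univ_two]
  simp only [Matrix.cons_val_zero, Matrix.cons_val_one, add_sub_cancel_left]
  rw [← ENNReal.ofReal_mul (by positivity)]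
  congr 1
  ring

lemma pairwise_disjoint_latticeBrick : Pairwise (Function.onFun Disjoint latticeBrick) := by
  rintro ⟨i, j⟩ ⟨k, l⟩ huv
  refine Set.disjoint_left.2 fun x hx hx' => huv ?_
  rw [mem_latticeBrick] at hx hx'
  obtain ⟨⟨h1, h2⟩, h3, h4⟩ := hx
  obtain ⟨⟨h5, h6⟩, h7, h8⟩ := hx'
  simp only at *
  have hpos : 0 < Real.sqrt 3 := by positivity
  have hjl : j = l := by
    have h9 : (j : ℝ) < l + 1 := by linarith
    have h10 : (l : ℝ) < j + 1 := by linarith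
    norm_cast at h9 h10
    omega
  subst hjl
  have h9 : (i : ℝ) < k + 1 := by nlinarith
  have h10 : (k : ℝ) < i + 1 := by nlinarith
  norm_cast at h9 h10
  rw [show i = k by omega]

lemma norm_sub_shrunkLattice_le {ij : ℤ × ℤ} {x : Euc2} (hx : x ∈ latticeBrick ij) :
    ‖x - shrunkLattice ij‖ ≤ 8 := by
  obtain ⟨⟨h1, h2⟩, h3, h4⟩ := mem_latticeBrick.1 hx
  have h5 := abs_le.1 (abs_shrink_sub_self_le (Real.sqrt 3 * (2 * ij.1 + ij.2)))
  have h6 := abs_le.1 (abs_shrink_sub_self_le (3 * ij.2))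
  have h7 : Real.sqrt 3 ≤ 2 := by rw [Real.sqrt_le_left (by norm_num)]; norm_num
  rw [EuclideanSpace.norm_eq, Fin.sum_univ_two]
  apply Real.sqrt_le_iff.2 ⟨by norm_num, ?_⟩
  simp only [shrunkLattice, Real.norm_eq_abs, sq_abs, PiLp.sub_apply, Matrix.cons_val_zero,
    Matrix.cons_val_one]
  nlinarith

lemma densityIn_shrunkLattice_le {r : ℝ} (hr : 0 < r) :
    densityIn (Set.range fun u => Metric.closedBall (shrunkLattice u) 1) r ≤
      ENNReal.ofReal (Real.pi / (6 * Real.sqrt 3) * ((r + 9) / r) ^ 2) := by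
  set κ := ENNReal.ofReal (Real.pi / (6 * Real.sqrt 3)) with hκ
  have hterm : ∀ u, volume (Metric.closedBall (shrunkLattice u) 1 ∩ Metric.ball 0 r) ≤
      κ * volume (latticeBrick u ∩ Metric.ball 0 (r + 9)) := by
    intro u
    rcases Set.eq_empty_or_nonempty (Metric.closedBall (shrunkLattice u) 1 ∩ Metric.ball 0 r)
      with h | ⟨z, hz1, hz2⟩
    · simp [h]
    · have hsub : latticeBrick u ⊆ Metric.ball 0 (r + 9) := by
        intro x hx
        rw [Metric.mem_closedBall, dist_comm, dist_eq_norm] at hz1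
        rw [mem_ball_zero_iff] at hz2 ⊢
        linarith [norm_sub_shrunkLattice_le hx, norm_sub_norm_le x (shrunkLattice u),
          norm_sub_norm_le (shrunkLattice u) z]
      rw [Set.inter_eq_left.2 hsub, volume_latticeBrick, hκ, ← ENNReal.ofReal_mul (by positivity),
        div_mul_cancel₀ _ (by positivity)]
      refine (measure_mono Set.inter_subset_left).trans_eq ?_
      rw [Measure.addHaar_closedBall_eq_addHaar_ball, volume_euc2_ball _ zero_le_one]
      simp
  have hsum : ∑' L : Set.range fun u => Metric.closedBall (shrunkLattice u) 1,
      volume ((L : Set Euc2) ∩ Metric.ball 0 r) ≤ κ * volume (Metric.ball (0 : Euc2) (r + 9)) := by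
    calc _ ≤ ∑' u, volume (Metric.closedBall (shrunkLattice u) 1 ∩ Metric.ball 0 r) :=
          ENNReal.tsum_le_tsum_comp_of_surjective
            (f := Set.rangeFactorization fun u => Metric.closedBall (shrunkLattice u) 1)
            Set.rangeFactorization_surjective _
      _ ≤ ∑' u, κ * volume (latticeBrick u ∩ Metric.ball 0 (r + 9)) := ENNReal.tsum_le_tsum hterm
      _ = κ * ∑' u, volume (latticeBrick u ∩ Metric.ball 0 (r + 9)) := ENNReal.tsum_mul_left
      _ ≤ κ * volume (⋃ u, latticeBrick u ∩ Metric.ball 0 (r + 9)) := by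
          gcongr
          exact tsum_meas_le_meas_iUnion_of_disjoint _
            (fun u => (measurableSet_latticeBrick u).inter measurableSet_ball)
            fun u v huv => (pairwise_disjoint_latticeBrick huv).mono Set.inter_subset_left
              Set.inter_subset_left
      _ ≤ κ * volume (Metric.ball (0 : Euc2) (r + 9)) := by
          gcongr
          exact Set.iUnion_subset fun u => Set.inter_subset_right
  refine (ENNReal.div_le_div_right hsum _).trans_eq ?_
  rw [volume_euc2_ball 0 hr.le, volume_euc2_ball 0 (by linarith), hκ,
    ← ENNReal.ofReal_mul (by positivity), ← ENNReal.ofReal_div_of_pos (by positivity)]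
  congr 1
  field_simp

/-- Every saturated packing of the plane with closed unit disks has lower density at
least `π/(6√3)`, and some saturated packing with unit disks has density existing and
equal to `π/(6√3)`.  Hence `Δ₁(B²) = π/(6√3) = 0.302299…`. -/
theorem saturated_unit_disk_packing_density :
    (∀ P : Set (Set Euc2), IsSaturatedDiskPacking P →
        ENNReal.ofReal (Real.pi / (6 * Real.sqrt 3)) ≤ lowerDensity P) ∧
    (∃ P : Set (Set Euc2), IsSaturatedDiskPacking P ∧
        Filter.Tendsto (fun r : ℝ => densityIn P r) Filter.atTop
          (nhds (ENNReal.ofReal (Real.pi / (6 * Real.sqrt 3))))) := by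
  refine ⟨fun P hP => hP.le_lowerDensity, _, isSaturatedDiskPacking_shrunkLattice, ?_⟩
  refine tendsto_of_tendsto_of_tendsto_of_le_of_le' (tendsto_density_bound (-6))
    (tendsto_density_bound 9) ?_ ?_
  · filter_upwards [Filter.eventually_gt_atTop 6] with r hr
    exact isSaturatedDiskPacking_shrunkLattice.le_densityIn hr
  · filter_upwards [Filter.eventually_gt_atTop 0] with r hr
    exact densityIn_shrunkLattice_le hr
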